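/- Let F_q be a finite field of odd characteristic and let f(x) = ax² + bx + c ∈ F_q[x] with a ≠ 0. Then f is dynamically irreducible over F_q if and only if the set {−a·f(−b/(2a))} ∪ {a·f^n(−b/(2a)) : n an integer ≥ 2} contains no squares in F_q. -/

import Mathlib

open Polynomial

/-- The `n`-fold composition `f ∘ f ∘ ... ∘ f` (`n` times) of a polynomial,
with `f^0 = X` (the identity). -/
noncomputable def polyIter {K : Type*} [Field K] (f : K[X]) : ℕ → K[X]
  | 0 => X
  | n + 1 => f.comp (polyIter f n)

theorem FiniteField.isSquare_norm_iff {K L : Type*} [Field K] [Finite K] [Field L] [Finite L]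
    [Algebra K L] (hK : ringChar K ≠ 2) (x : L) :
    IsSquare (Algebra.norm K x) ↔ IsSquare x := by
  rcases eq_or_ne x 0 with rfl | hx
  · simp [Algebra.norm_zero]
  have := Fintype.ofFinite K
  have := Fintype.ofFinite L
  have hL : ringChar L ≠ 2 := by rwa [← Algebra.ringChar_eq K L]
  rw [FiniteField.isSquare_iff hK (Algebra.norm_ne_zero_iff.mpr hx), FiniteField.isSquare_iff hL hx,
    ← (algebraMap K L).injective.eq_iff, map_pow, FiniteField.algebraMap_norm_eq_pow, map_one,
    ← pow_mul, Nat.card_eq_fintype_card, Nat.card_eq_fintype_card]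
  have hq := FiniteField.odd_card_of_char_ne_two hK
  have hQ := FiniteField.odd_card_of_char_ne_two hL
  have hdvd : Fintype.card K - 1 ∣ Fintype.card L - 1 := by
    rw [Module.card_eq_pow_finrank (K := K) (V := L)]
    simpa using Nat.sub_dvd_pow_sub_pow (Fintype.card K) 1 (Module.finrank K L)
  have hexp : (Fintype.card L - 1) / (Fintype.card K - 1) * (Fintype.card K / 2) =
      Fintype.card L / 2 := by
    obtain ⟨k, hk⟩ := hdvd
    have h1 : Fintype.card K - 1 = 2 * (Fintype.card K / 2) := by omega
    have h2 : Fintype.card L - 1 = 2 * (Fintype.card L / 2) := by omega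
    have h3 : 1 < Fintype.card K := Fintype.one_lt_card
    rw [hk, Nat.mul_div_cancel_left _ (by omega)]
    rw [h1, h2] at hk
    nlinarith
  rw [hexp]

theorem AdjoinRoot.norm_root_sub_of_mul_leadingCoeff {K : Type*} [Field K] {P : K[X]}
    [Fact (Irreducible P)] (m : K) :
    Algebra.norm K (root P - of P m) * P.leadingCoeff = (-1) ^ P.natDegree * P.eval m := by
  have hP : P ≠ 0 := (Fact.out : Irreducible P).ne_zero
  have hl : P.leadingCoeff ≠ 0 := leadingCoeff_ne_zero.mpr hP
  let pb := powerBasis hP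
  have hchar := charpoly_leftMulMatrix pb
  have hev := Matrix.eval_charpoly (Algebra.leftMulMatrix pb.basis pb.gen) m
  rw [hchar, powerBasis_gen, minpoly_root hP] at hev
  have hmat : Matrix.scalar (Fin pb.dim) m - Algebra.leftMulMatrix pb.basis (root P) =
      Algebra.leftMulMatrix pb.basis (-(root P - of P m)) := by
    rw [neg_sub, map_sub, ← algebraMap_eq, AlgHom.commutes]
    rfl
  rw [hmat, ← Algebra.norm_eq_matrix_det, neg_eq_neg_one_mul, map_mul] at hev
  have hneg : Algebra.norm K (-1 : AdjoinRoot P) = (-1) ^ P.natDegree := by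
    have h := Algebra.norm_algebraMap (S := AdjoinRoot P) (-1 : K)
    rwa [map_neg, map_one, (powerBasis hP).finrank, powerBasis_dim] at h
  rw [hneg, eval_mul, eval_C] at hev
  have hsq : ((-1 : K) ^ P.natDegree) * (-1) ^ P.natDegree = 1 := by
    rw [← mul_pow]; simp
  field_simp at hev
  linear_combination (-(-1) ^ P.natDegree) * hev -
    Algebra.norm K (root P - of P m) * P.leadingCoeff * hsq

theorem irreducible_comp_quadratic_iff {K : Type*} [Field K] {P : K[X]} [hP : Fact (Irreducible P)]
    {a : K} (ha : a ≠ 0) (γ m : K) :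
    Irreducible (P.comp (C a * (X - C γ) ^ 2 + C m)) ↔
      ¬ IsSquare ((AdjoinRoot.root P - AdjoinRoot.of P m) * AdjoinRoot.of P a⁻¹) := by
  set f : K[X] := C a * (X - C γ) ^ 2 + C m with hf
  have hfdeg : f.natDegree = 2 := by
    rw [hf, natDegree_add_C, natDegree_C_mul ha, natDegree_pow, natDegree_X_sub_C]
  have hP0 : P ≠ 0 := hP.out.ne_zero
  have hPpos : 0 < P.natDegree := hP.out.natDegree_pos
  have hcdeg : (P.comp f).natDegree = 2 * P.natDegree := by
    rw [natDegree_comp, hfdeg, mul_comm]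
  have hc0 : P.comp f ≠ 0 := by
    intro h
    rw [h, natDegree_zero] at hcdeg
    omega
  have hfin : FiniteDimensional K (AdjoinRoot P) := (AdjoinRoot.powerBasis hP0).finite
  have hrank : Module.finrank K (AdjoinRoot P) = P.natDegree := by
    rw [(AdjoinRoot.powerBasis hP0).finrank, AdjoinRoot.powerBasis_dim]
  constructor
  · rintro hirr ⟨s, hs⟩
    have ha' : AdjoinRoot.of P a * AdjoinRoot.of P a⁻¹ = 1 := by
      rw [← map_mul, mul_inv_cancel₀ ha, map_one]
    have hroot : aeval (AdjoinRoot.of P γ + s) f = AdjoinRoot.root P := by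
      simp only [hf, map_add, map_mul, map_pow, map_sub, aeval_C, aeval_X, AdjoinRoot.algebraMap_eq]
      linear_combination (-AdjoinRoot.of P a) * hs +
        (AdjoinRoot.root P - AdjoinRoot.of P m) * ha'
    have hz : aeval (AdjoinRoot.of P γ + s) (P.comp f) = 0 := by
      rw [aeval_comp, hroot, AdjoinRoot.aeval_eq, AdjoinRoot.mk_self]
    have hmin := minpoly.eq_of_irreducible hirr hz
    have hle := minpoly.natDegree_le (A := K) (AdjoinRoot.of P γ + s)
    rw [← hmin, natDegree_mul_C (inv_ne_zero (leadingCoeff_ne_zero.mpr hc0)), hcdeg, hrank] at hle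
    omega
  · intro hns
    have hnu : ¬ IsUnit (P.comp f) := fun h => by
      have := natDegree_eq_zero_of_isUnit h
      omega
    obtain ⟨h, hirr, hdvd⟩ := WfDvdMonoid.exists_irreducible_factor hnu hc0
    have := Fact.mk hirr
    have hfinM : FiniteDimensional K (AdjoinRoot h) := (AdjoinRoot.powerBasis hirr.ne_zero).finite
    have hrankM : Module.finrank K (AdjoinRoot h) = h.natDegree := by
      rw [(AdjoinRoot.powerBasis hirr.ne_zero).finrank, AdjoinRoot.powerBasis_dim]
    have hz : aeval (aeval (AdjoinRoot.root h) f) P = 0 := by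
      rw [← aeval_comp, AdjoinRoot.aeval_eq, AdjoinRoot.mk_eq_zero]
      exact hdvd
    let φ : AdjoinRoot P →ₐ[K] AdjoinRoot h :=
      AdjoinRoot.liftAlgHom P (Algebra.ofId K (AdjoinRoot h)) (aeval (AdjoinRoot.root h) f) hz
    have hφroot : φ (AdjoinRoot.root P) = aeval (AdjoinRoot.root h) f := by
      simp [φ]
    have hφof (x : K) : φ (AdjoinRoot.of P x) = AdjoinRoot.of h x := φ.commutes x
    have hdiv : P.natDegree ∣ h.natDegree := by
      let _ : Algebra (AdjoinRoot P) (AdjoinRoot h) := φ.toRingHom.toAlgebra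
      have : IsScalarTower K (AdjoinRoot P) (AdjoinRoot h) :=
        IsScalarTower.of_algebraMap_eq fun x => (φ.commutes x).symm
      rw [← hrank, ← hrankM]
      exact ⟨_, (Module.finrank_mul_finrank K (AdjoinRoot P) (AdjoinRoot h)).symm⟩
    have hne : h.natDegree ≠ P.natDegree := by
      intro heq
      have hinj : Function.Injective φ := φ.toRingHom.injective
      have hsurj : Function.Surjective φ :=
        (LinearMap.injective_iff_surjective_of_finrank_eq_finrank (f := φ.toLinearMap)
          (by rw [hrank, hrankM, heq])).mp hinj
      obtain ⟨s, hs⟩ := hsurj (AdjoinRoot.root h)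
      refine hns ⟨s - AdjoinRoot.of P γ, hinj ?_⟩
      have ha' : AdjoinRoot.of h a * AdjoinRoot.of h a⁻¹ = 1 := by
        rw [← map_mul, mul_inv_cancel₀ ha, map_one]
      simp only [map_mul, map_sub, hφof, hφroot, hs]
      simp only [hf, map_add, map_mul, map_pow, map_sub, aeval_C, aeval_X, AdjoinRoot.algebraMap_eq]
      linear_combination (AdjoinRoot.root h - AdjoinRoot.of h γ) ^ 2 * ha'
    have hle : (P.comp f).natDegree ≤ h.natDegree := by
      obtain ⟨k, hk⟩ := hdiv
      have hpos := hirr.natDegree_pos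
      have hk2 : 2 ≤ k := by
        by_contra! hlt
        interval_cases k <;> omega
      rw [hcdeg, hk, mul_comm]
      exact Nat.mul_le_mul_left _ hk2
    exact (associated_of_dvd_of_natDegree_le hdvd hc0 hle).irreducible hirr

theorem irreducible_comp_quadratic_iff_not_isSquare {K : Type*} [Field K] [Finite K]
    (hK : ringChar K ≠ 2) {P : K[X]} (hP : Irreducible P) {a : K} (ha : a ≠ 0) (γ m : K) :
    Irreducible (P.comp (C a * (X - C γ) ^ 2 + C m)) ↔
      ¬ IsSquare ((-1) ^ P.natDegree * P.eval m * P.leadingCoeff * a ^ P.natDegree) := by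
  have := Fact.mk hP
  have hl : P.leadingCoeff ≠ 0 := leadingCoeff_ne_zero.mpr hP.ne_zero
  have hfin : FiniteDimensional K (AdjoinRoot P) := (AdjoinRoot.powerBasis hP.ne_zero).finite
  have : Finite (AdjoinRoot P) := Module.finite_of_finite K
  have hnorm : Algebra.norm K (AdjoinRoot.of P a⁻¹) = a⁻¹ ^ P.natDegree := by
    rw [← AdjoinRoot.algebraMap_eq, Algebra.norm_algebraMap,
      (AdjoinRoot.powerBasis hP.ne_zero).finrank, AdjoinRoot.powerBasis_dim]
  rw [irreducible_comp_quadratic_iff ha, ← FiniteField.isSquare_norm_iff hK, map_mul, hnorm,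
    ← AdjoinRoot.norm_root_sub_of_mul_leadingCoeff]
  set N := Algebra.norm K (AdjoinRoot.root P - AdjoinRoot.of P m)
  have h : N * P.leadingCoeff * P.leadingCoeff * a ^ P.natDegree =
      N * a⁻¹ ^ P.natDegree * (P.leadingCoeff * a ^ P.natDegree) ^ 2 := by
    rw [inv_pow]
    field_simp
  rw [h, not_iff_not]
  refine ⟨fun hs => hs.mul (IsSquare.sq _), fun hs => ?_⟩
  have h' := hs.div (IsSquare.sq (P.leadingCoeff * a ^ P.natDegree))
  rwa [mul_div_cancel_right₀] at h'
  positivity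

theorem polyIter_succ_eq_comp {K : Type*} [Field K] (f : K[X]) (n : ℕ) :
    polyIter f (n + 1) = (polyIter f n).comp f := by
  induction n with
  | zero => simp [polyIter]
  | succ n ih => rw [polyIter, ih, ← comp_assoc, ← ih]; rfl

theorem eval_polyIter {K : Type*} [Field K] (f : K[X]) (n : ℕ) (x : K) :
    (polyIter f n).eval x = (fun t => f.eval t)^[n] x := by
  induction n with
  | zero => simp [polyIter]
  | succ n ih => rw [polyIter, eval_comp, ih, Function.iterate_succ_apply']

theorem natDegree_polyIter {K : Type*} [Field K] (f : K[X]) (n : ℕ) :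
    (polyIter f n).natDegree = f.natDegree ^ n := by
  induction n with
  | zero => simp [polyIter]
  | succ n ih => rw [polyIter, natDegree_comp, ih, pow_succ']

theorem leadingCoeff_polyIter_mul_leadingCoeff {K : Type*} [Field K] {f : K[X]}
    (hf : f.natDegree = 2) (n : ℕ) :
    (polyIter f n).leadingCoeff * f.leadingCoeff = f.leadingCoeff ^ 2 ^ n := by
  induction n with
  | zero => simp [polyIter]
  | succ n ih =>
    rw [polyIter, leadingCoeff_comp (by simp [natDegree_polyIter, hf]), hf, pow_succ 2 n, pow_mul, ← ih]
    ring

theorem irreducible_polyIter_succ_iff {K : Type*} [Field K] [Finite K] (hK : ringChar K ≠ 2)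
    {a : K} (ha : a ≠ 0) (γ m : K) {f : K[X]} (hf : f = C a * (X - C γ) ^ 2 + C m) {n : ℕ}
    (hirr : Irreducible (polyIter f n)) :
    Irreducible (polyIter f (n + 1)) ↔
      ¬ IsSquare ((-1) ^ 2 ^ n * a * (fun t => f.eval t)^[n + 1] γ) := by
  have hdeg : f.natDegree = 2 := by
    rw [hf, natDegree_add_C, natDegree_C_mul ha, natDegree_pow, natDegree_X_sub_C]
  have hlead : f.leadingCoeff = a := by
    have : C a * (X - C γ) ^ 2 + C m =
        C a * X ^ 2 + C (-2 * a * γ) * X + C (a * γ ^ 2 + m) := by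
      simp only [map_mul, map_add, map_neg, map_pow, map_ofNat]
      ring
    rw [hf, this, leadingCoeff_quadratic ha]
  have hγ : f.eval γ = m := by simp [hf]
  have hl := leadingCoeff_polyIter_mul_leadingCoeff hdeg n
  rw [hlead] at hl
  have hl0 : (polyIter f n).leadingCoeff ≠ 0 := leadingCoeff_ne_zero.mpr hirr.ne_zero
  have key := irreducible_comp_quadratic_iff_not_isSquare hK hirr ha γ m
  rw [← hf, ← polyIter_succ_eq_comp, natDegree_polyIter, hdeg, ← hl, eval_polyIter, ← hγ] at key
  rw [key, Function.iterate_succ_apply, not_iff_not]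
  set v := (fun t => f.eval t)^[n] (f.eval γ)
  set l := (polyIter f n).leadingCoeff
  have h : (-1) ^ 2 ^ n * v * l * (l * a) = (-1) ^ 2 ^ n * a * v * l ^ 2 := by ring
  rw [h]
  refine ⟨fun hs => ?_, fun hs => hs.mul (IsSquare.sq _)⟩
  have h' := hs.div (IsSquare.sq l)
  rwa [mul_div_cancel_right₀ _ (pow_ne_zero 2 hl0)] at h'

theorem stmt13 {K : Type*} [Field K] [Fintype K] (hchar : ringChar K ≠ 2)
    (a b c : K) (ha : a ≠ 0) (f : K[X])
    (hf : f = C a * X ^ 2 + C b * X + C c) :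
    (∀ n : ℕ, 0 < n → Irreducible (polyIter f n)) ↔
      ((¬ ∃ v : K, v ^ 2 = -a * f.eval (-b / (2 * a))) ∧
       ∀ n : ℕ, 2 ≤ n →
         ¬ ∃ v : K, v ^ 2 = a * (fun t => f.eval t)^[n] (-b / (2 * a))) := by
  have h2 : (2 : K) ≠ 0 := Ring.two_ne_zero hchar
  set γ := -b / (2 * a) with hγ
  have hb : b = -(2 * a * γ) := by
    rw [hγ]
    field_simp
  have hvertex : f = C a * (X - C γ) ^ 2 + C (c - a * γ ^ 2) := by
    rw [hf, hb]
    simp only [map_mul, map_sub, map_neg, map_pow, map_ofNat]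
    ring
  have hsq (x : K) : (∃ v : K, v ^ 2 = x) ↔ IsSquare x := by
    rw [isSquare_iff_exists_sq]
    simp only [eq_comm]
  simp only [hsq]
  have h0 : Irreducible (polyIter f 0) := irreducible_X
  have hone := irreducible_polyIter_succ_iff hchar ha γ _ hvertex h0
  have hstep {n : ℕ} (h : Irreducible (polyIter f (n + 1))) :=
    irreducible_polyIter_succ_iff hchar ha γ _ hvertex h
  have heven (n : ℕ) : (-1 : K) ^ 2 ^ (n + 1) = 1 := by rw [pow_succ', pow_mul]; simp
  simp only [heven, one_mul] at hstep
  simp only [pow_zero, pow_one, zero_add, neg_one_mul, Function.iterate_one] at hone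
  constructor
  · intro h
    refine ⟨hone.mp (h 1 one_pos), fun n hn => ?_⟩
    obtain ⟨k, rfl⟩ := Nat.exists_eq_add_of_le' hn
    exact (hstep (h (k + 1) k.succ_pos)).mp (h (k + 2) (by omega))
  · rintro ⟨h1, hn⟩ n hpos
    induction n, hpos using Nat.le_induction with
    | base => exact hone.mpr h1
    | succ n hle ih =>
      obtain ⟨k, rfl⟩ := Nat.exists_eq_add_of_le' hle
      exact (hstep ih).mpr (hn (k + 2) (by omega))
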